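/- Let N ≥ 2 and let u, v, u', v' ∈ ℂ^N. Assume: (i) u_j ≠ 0 for all j; (ii) ∏_{j=1}^N u_j = ∏_{j=1}^N u'_j; (iii) ∏_{j=1}^N u_j ≠ ∏_{j=1}^N v_j; and (iv) X(v,z)·X(u,z) = X(v',z)·X(u',z) for every z ∈ ℂ. Then u' = u and v' = v. (Uniqueness of the ordered factorization: the factors of a product of two such matrices are determined by their determinants, via the kernel of the product at the zero z = (−1)^N ∏ u_j of det X(u,·).) -/

import Mathlib

/-- The `N×N` matrix `X(u,z) = diag(u_1,…,u_N) + Λ`, where `Λ` has `1` on the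
superdiagonal, `z` in the bottom-left corner, and `0` elsewhere. -/
def Xmat (N : ℕ) (u : Fin N → ℂ) (z : ℂ) : Matrix (Fin N) (Fin N) ℂ :=
  Matrix.of fun i j =>
    (if i = j then u i else 0) + (if (i : ℕ) + 1 = (j : ℕ) then 1 else 0) +
    (if (i : ℕ) = N - 1 ∧ (j : ℕ) = 0 then z else 0)

theorem Xmat_apply' (n : ℕ) (u : Fin (n+2) → ℂ) (z : ℂ) (i k : Fin (n+2)) :
    Xmat (n+2) u z i k = (if i = k then u i else 0) +
      (if i + 1 = k then (if i = Fin.last (n+1) then z else 1) else 0) := by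
  simp only [Xmat, Matrix.of_apply, add_assoc]
  congr 1
  have hk := k.isLt
  have hi := i.isLt
  have h1 : (i + 1 = k) ↔ ((i+1 : Fin (n+2)) : ℕ) = (k : ℕ) := Fin.ext_iff
  simp only [h1, Fin.val_add_one]
  by_cases h : i = Fin.last (n+1)
  · subst h
    have : ¬ (n + 1 + 1 = (k : ℕ)) := by omega
    simp [this, eq_comm]
  · have : ¬ ((i : ℕ) = n + 1) := fun h' => h (Fin.ext h')
    simp [h, this]

theorem Xmat_mul' (n : ℕ) (u : Fin (n+2) → ℂ) (z : ℂ) (M : Matrix (Fin (n+2)) (Fin (n+2)) ℂ)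
    (i j : Fin (n+2)) :
    (Xmat (n+2) u z * M) i j = u i * M i j +
      (if i = Fin.last (n+1) then z else 1) * M (i+1) j := by
  simp [Matrix.mul_apply, Xmat_apply', add_mul, Finset.sum_add_distrib, ite_mul]

theorem stmt8 (N : ℕ) (hN : 2 ≤ N) (u v u' v' : Fin N → ℂ)
    (hu0 : ∀ j, u j ≠ 0)
    (hprod : (∏ j, u j) = ∏ j, u' j)
    (hne : (∏ j, u j) ≠ ∏ j, v j)
    (hfact : ∀ z : ℂ, Xmat N v z * Xmat N u z = Xmat N v' z * Xmat N u' z) :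
    u' = u ∧ v' = v := by
  obtain ⟨n, rfl⟩ : ∃ n, N = n + 2 := ⟨N - 2, by omega⟩
  have hs : ∀ i : Fin (n+2), i + 1 ≠ i := by intro i; simp
  have hs' : ∀ i : Fin (n+2), i ≠ i + 1 := fun i => (hs i).symm
  have key : ∀ (z : ℂ) (i j : Fin (n+2)), _ := fun z i j => congrFun (congrFun (hfact z) i) j
  simp only [Xmat_mul', Xmat_apply'] at key
  have hB : ∀ i, v i + u (i+1) = v' i + u' (i+1) := by
    intro i
    have h := key 1 i (i+1)
    simpa [hs, hs'] using h
  have hA : ∀ i, v i * u i = v' i * u' i := by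
    intro i
    have h := key 1 i i
    simpa [hs, hs'] using h
  have hu' : ∀ i, u' i ≠ 0 := by
    have : (∏ j, u' j) ≠ 0 := by
      rw [← hprod]; exact Finset.prod_ne_zero_iff.2 fun j _ => hu0 j
    exact fun i => Finset.prod_ne_zero_iff.1 this i (Finset.mem_univ i)
  have hd : ∀ i, v i * (u' i - u i) = (u' (i+1) - u (i+1)) * u' i := by
    intro i
    linear_combination (-1) * hA i + u' i * hB i
  have hP : (∏ i, v i) * (∏ i, (u' i - u i)) = (∏ i, (u' i - u i)) * ∏ i, u' i := by
    rw [← Finset.prod_mul_distrib, Finset.prod_congr rfl fun i _ => hd i,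
      Finset.prod_mul_distrib]
    congr 1
    exact Equiv.prod_comp (Equiv.addRight (1 : Fin (n+2))) (fun i => u' i - u i)
  have h0 : (∏ i, (u' i - u i)) = 0 := by
    by_contra h
    apply hne
    rw [hprod]
    apply mul_left_cancel₀ h
    rw [← hP, mul_comm]
  obtain ⟨i, -, hi⟩ := Finset.prod_eq_zero_iff.1 h0
  have step : ∀ i, u' i - u i = 0 → u' (i+1) - u (i+1) = 0 := by
    intro i h
    have := hd i
    rw [h, mul_zero] at this
    exact (mul_eq_zero.1 this.symm).resolve_right (hu' i)
  have all : ∀ k : ℕ, u' (i + k • (1 : Fin (n+2))) - u (i + k • (1 : Fin (n+2))) = 0 := by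
    intro k
    induction k with
    | zero => simpa using hi
    | succ k ih =>
      have := step _ ih
      rw [add_assoc] at this
      rw [succ_nsmul]
      exact this
  have hk : ∀ m : Fin (n+2), ∃ k : ℕ, k • (1 : Fin (n+2)) = m := by
    intro m
    induction m using Fin.induction with
    | zero => exact ⟨0, by simp⟩
    | succ m ih =>
      obtain ⟨k, hk⟩ := ih
      exact ⟨k + 1, by rw [succ_nsmul, hk, Fin.coeSucc_eq_succ]⟩
  have huu : ∀ j, u' j = u j := by
    intro j
    obtain ⟨k, hk⟩ := hk (j - i)
    have := all k
    rw [hk, add_sub_cancel] at this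
    exact sub_eq_zero.1 this
  refine ⟨funext huu, funext fun j => ?_⟩
  have := hB j
  rw [huu] at this
  exact (add_right_cancel this).symm
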